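/- arXiv:2012.01178 — 9 statements merged into one kernel-verified Lean document; each statement's English description precedes it below -/
import Mathlib

section
/- For every n ≥ 0, the number of S-Motzkin paths of length 3n equals binom(3n, n)/(2n+1); equivalently, (2n+1) times the number of S-Motzkin paths of length 3n equals binom(3n, n). -/
/-- Steps of a Motzkin path: up, horizontal, down. -/
inductive Step : Type
  | U : Step
  | H : Step
  | D : Step
  deriving DecidableEq

/-- `IsSMotzkin n w` says that the word `w` over `{U, H, D}` is an S-Motzkin path
of length `3n`: it has length `3n`, every prefix contains at least as many `U`'s
as `D`'s, it has equally many `U`'s and `D`'s, and deleting all `D`'s yields the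
alternating word `H U H U ⋯ H U` (with `n` letters `H` and `n` letters `U`). -/
def IsSMotzkin (n : ℕ) (w : List Step) : Prop :=
  w.length = 3 * n ∧
  (∀ p : List Step, p <+: w → p.count Step.D ≤ p.count Step.U) ∧
  w.count Step.U = w.count Step.D ∧
  w.filter (fun s => s ≠ Step.D) = (List.replicate n [Step.H, Step.U]).flatten

namespace SMotzkin

/-- The `i`-th letter (counted from `0`) of the infinite alternating word `H U H U ⋯`. -/
def letter (i : ℕ) : Step := if i % 2 = 0 then Step.H else Step.U

/-- The first `i` letters of the infinite alternating word `H U H U ⋯`. -/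
def alternating : ℕ → List Step
  | 0 => []
  | i + 1 => alternating i ++ [letter i]

/-- The words with `j` letters `D` in which every prefix has at least as many `U`'s as `D`'s and
which become the alternating word of length `i` once all `D`'s are deleted. -/
def paths (i j : ℕ) : Set (List Step) :=
  {w | (∀ p : List Step, p <+: w → p.count Step.D ≤ p.count Step.U) ∧
    w.filter (fun s => s ≠ Step.D) = alternating i ∧ w.count Step.D = j}

lemma letter_ne_D (i : ℕ) : letter i ≠ Step.D := by
  unfold letter; split_ifs <;> simp

lemma length_alternating (i : ℕ) : (alternating i).length = i := by
  induction i with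
  | zero => rfl
  | succ i ih => simp [alternating, ih]

lemma count_U_alternating (i : ℕ) : (alternating i).count Step.U = i / 2 := by
  induction i with
  | zero => rfl
  | succ i ih =>
    rw [alternating, List.count_append, ih, letter]
    split_ifs
    · simp; omega
    · simp; omega

lemma alternating_two_mul (n : ℕ) :
    alternating (2 * n) = (List.replicate n [Step.H, Step.U]).flatten := by
  induction n with
  | zero => rfl
  | succ n ih =>
    rw [List.replicate_succ', List.flatten_concat, ← ih, Nat.mul_succ, alternating, alternating]
    simp [letter, Nat.add_mod]

lemma count_U_filter (w : List Step) :
    (w.filter (fun s => s ≠ Step.D)).count Step.U = w.count Step.U :=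
  List.count_filter (by simp)

lemma length_filter_add_count (w : List Step) :
    (w.filter (fun s => s ≠ Step.D)).length + w.count Step.D = w.length := by
  induction w with
  | nil => rfl
  | cons s w ih => cases s <;> simp_all <;> omega

lemma count_U_of_mem_paths {i j : ℕ} {w : List Step} (h : w ∈ paths i j) :
    w.count Step.U = i / 2 := by
  rw [← count_U_filter, h.2.1, count_U_alternating]

lemma two_mul_le_of_mem_paths {i j : ℕ} {w : List Step} (h : w ∈ paths i j) : 2 * j ≤ i := by
  have h1 := h.1 w List.prefix_rfl
  rw [count_U_of_mem_paths h, h.2.2] at h1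
  omega

lemma isSMotzkin_iff (n : ℕ) (w : List Step) : IsSMotzkin n w ↔ w ∈ paths (2 * n) n := by
  constructor
  · rintro ⟨-, hp, hc, hf⟩
    rw [← alternating_two_mul] at hf
    refine ⟨hp, hf, ?_⟩
    rw [← hc, ← count_U_filter, hf, count_U_alternating]
    omega
  · intro h
    have hU := count_U_of_mem_paths h
    obtain ⟨hp, hf, hc⟩ := h
    refine ⟨?_, hp, by omega, by rw [hf, alternating_two_mul]⟩
    rw [← length_filter_add_count, hf, length_alternating, hc]
    omega

lemma paths_eq_empty {i j : ℕ} (h : i < 2 * j) : paths i j = ∅ := by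
  ext w
  simpa using fun hw => absurd (two_mul_le_of_mem_paths hw) (by omega)

lemma append_D_mem_paths {i j : ℕ} {w : List Step} :
    w ++ [Step.D] ∈ paths i (j + 1) ↔ w ∈ paths i j ∧ 2 * (j + 1) ≤ i := by
  constructor
  · intro h
    refine ⟨⟨fun p hp => h.1 p (hp.trans (List.prefix_append _ _)), ?_, ?_⟩,
      two_mul_le_of_mem_paths h⟩
    · simpa using h.2.1
    · simpa using h.2.2
  · rintro ⟨h, hij⟩
    have hU := count_U_of_mem_paths h
    refine ⟨fun p hp => ?_, by simpa using h.2.1, by simpa using h.2.2⟩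
    rcases List.prefix_concat_iff.1 hp with rfl | hp
    · have := h.2.2
      simp
      omega
    · exact h.1 p hp

lemma append_mem_paths {i j : ℕ} {w : List Step} {s : Step} (hs : s ≠ Step.D) :
    w ++ [s] ∈ paths (i + 1) j ↔ w ∈ paths i j ∧ s = letter i := by
  constructor
  · rintro ⟨hp, hf, hc⟩
    have hf' : w.filter (fun s => s ≠ Step.D) ++ [s] = alternating i ++ [letter i] := by
      simpa [alternating, hs] using hf
    obtain ⟨h1, h2⟩ := List.append_inj' hf' rfl
    refine ⟨⟨fun p h => hp p (h.trans (List.prefix_append _ _)), h1, ?_⟩, by simpa using h2⟩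
    simpa [List.count_singleton, hs] using hc
  · rintro ⟨h, rfl⟩
    refine ⟨fun p hp => ?_, ?_, ?_⟩
    · rcases List.prefix_concat_iff.1 hp with rfl | hp
      · have := h.1 w List.prefix_rfl
        simp [List.count_append, List.count_singleton, hs]
        omega
      · exact h.1 p hp
    · rw [List.filter_append, h.2.1]
      simp [alternating, hs]
    · simpa [List.count_singleton, hs] using h.2.2

lemma paths_zero_zero : paths 0 0 = {[]} := by
  ext w
  constructor
  · rintro ⟨-, hf, hc⟩
    have := length_filter_add_count w
    rw [hf, hc] at this
    exact List.length_eq_zero_iff.1 this.symm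
  · rintro rfl
    simp [paths, alternating]

lemma paths_succ_zero (i : ℕ) : paths (i + 1) 0 = (· ++ [letter i]) '' paths i 0 := by
  ext w
  constructor
  · intro h
    rcases List.eq_nil_or_concat' w with rfl | ⟨v, s, rfl⟩
    · simpa [alternating] using h.2.1
    · by_cases hs : s = Step.D
      · simpa [hs] using h.2.2
      · obtain ⟨hv, rfl⟩ := (append_mem_paths hs).1 h
        exact ⟨v, hv, rfl⟩
  · rintro ⟨v, hv, rfl⟩
    exact (append_mem_paths (letter_ne_D i)).2 ⟨hv, rfl⟩

lemma paths_succ_succ {i j : ℕ} (hij : 2 * (j + 1) ≤ i + 1) :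
    paths (i + 1) (j + 1) =
      (· ++ [letter i]) '' paths i (j + 1) ∪ (· ++ [Step.D]) '' paths (i + 1) j := by
  ext w
  constructor
  · intro h
    rcases List.eq_nil_or_concat' w with rfl | ⟨v, s, rfl⟩
    · simpa using h.2.2
    · by_cases hs : s = Step.D
      · subst hs
        exact Or.inr ⟨v, (append_D_mem_paths.1 h).1, rfl⟩
      · obtain ⟨hv, rfl⟩ := (append_mem_paths hs).1 h
        exact Or.inl ⟨v, hv, rfl⟩
  · rintro (⟨v, hv, rfl⟩ | ⟨v, hv, rfl⟩)
    · exact (append_mem_paths (letter_ne_D i)).2 ⟨hv, rfl⟩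
    · exact append_D_mem_paths.2 ⟨hv, hij⟩

lemma finite_paths (i j : ℕ) : (paths i j).Finite := by
  induction j generalizing i with
  | zero =>
    induction i with
    | zero => simp [paths_zero_zero]
    | succ i ih => rw [paths_succ_zero]; exact ih.image _
  | succ j ihj =>
    induction i with
    | zero => simp [paths_eq_empty (show 0 < 2 * (j + 1) by omega)]
    | succ i ih =>
      by_cases hij : 2 * (j + 1) ≤ i + 1
      · rw [paths_succ_succ hij]
        exact (ih.image _).union ((ihj _).image _)
      · simp [paths_eq_empty (not_le.1 hij)]

lemma ncard_paths_succ_zero (i : ℕ) : (paths (i + 1) 0).ncard = (paths i 0).ncard := by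
  rw [paths_succ_zero, Set.ncard_image_of_injective _ (List.append_left_injective _)]

lemma ncard_paths_succ_succ {i j : ℕ} (hij : 2 * (j + 1) ≤ i + 1) :
    (paths (i + 1) (j + 1)).ncard = (paths i (j + 1)).ncard + (paths (i + 1) j).ncard := by
  rw [paths_succ_succ hij, Set.ncard_union_eq _ ((finite_paths _ _).image _)
    ((finite_paths _ _).image _), Set.ncard_image_of_injective _ (List.append_left_injective _),
    Set.ncard_image_of_injective _ (List.append_left_injective _)]
  rw [Set.disjoint_left]
  rintro _ ⟨v, -, rfl⟩ ⟨u, -, h⟩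
  have := (List.append_inj' h rfl).2
  exact letter_ne_D i (by simpa using this.symm)

/-- The ballot formula for `paths`, with the subtraction moved to the other side. -/
lemma ncard_paths (i j : ℕ) (hij : 2 * j ≤ i + 1) :
    (i + 1) * (paths i j).ncard + 2 * j * (i + j).choose j = (i + 1) * (i + j).choose j := by
  induction j generalizing i with
  | zero =>
    have h : (paths i 0).ncard = 1 := by
      induction i with
      | zero => simp [paths_zero_zero]
      | succ i ih => rw [ncard_paths_succ_zero, ih (by omega)]
    simp [h]
  | succ j ihj =>
    induction i with
    | zero => omega
    | succ i ih =>
      by_cases h : 2 * (j + 1) ≤ i + 1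
      · have h1 := ih h
        have h2 := ihj (i + 1) (by omega)
        rw [ncard_paths_succ_succ h]
        have e1 : i + (j + 1) = i + j + 1 := by ring
        have e2 : i + 1 + j = i + j + 1 := by ring
        have e3 : i + 1 + (j + 1) = i + j + 1 + 1 := by ring
        rw [e1] at h1
        rw [e2] at h2
        rw [e3, Nat.choose_succ_succ]
        have h3 := Nat.choose_succ_right_eq (i + j + 1) j
        rw [show i + j + 1 - j = i + 1 by omega] at h3
        apply Nat.eq_of_mul_eq_mul_left (Nat.succ_pos i)
        zify at h1 h2 h3 ⊢
        linear_combination (i + 2 : ℤ) * h1 + (i + 1 : ℤ) * h2 - 2 * h3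
      · rw [paths_eq_empty (not_le.1 h), show i + 1 + 1 = 2 * (j + 1) by omega]
        simp

end SMotzkin

theorem sMotzkin_count (n : ℕ) :
    (2 * n + 1) * Nat.card {w : List Step // IsSMotzkin n w} = Nat.choose (3 * n) n := by
  have hcard : Nat.card {w : List Step // IsSMotzkin n w} = (SMotzkin.paths (2 * n) n).ncard :=
    Nat.card_congr (Equiv.subtypeEquivRight (SMotzkin.isSMotzkin_iff n))
  have h := SMotzkin.ncard_paths (2 * n) n (by omega)
  rw [show 2 * n + n = 3 * n by ring] at h
  rw [hcard]
  linarith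
end

section
/- For every h ≥ 3, the determinant D_h(z) satisfies the third-order recurrence D_h(z) = D_{h-1}(z) - 2z³·D_{h-2}(z) + z⁶·D_{h-3}(z). -/
/-- The `h × h` banded matrix with diagonal `1`, first superdiagonal `-2z`,
second superdiagonal `z²`, first subdiagonal `-z²`, and `0` elsewhere. -/
def bandMatrix {R : Type*} [CommRing R] (z : R) (h : ℕ) : Matrix (Fin h) (Fin h) R :=
  Matrix.of fun i j =>
    if (j : ℕ) = (i : ℕ) then 1
    else if (j : ℕ) = (i : ℕ) + 1 then -(2 * z)
    else if (j : ℕ) = (i : ℕ) + 2 then z ^ 2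
    else if (i : ℕ) = (j : ℕ) + 1 then -z ^ 2
    else 0

/-- `D h = det (bandMatrix z h)`; note `D 0 = 1` (determinant of the empty matrix). -/
noncomputable def Ddet {R : Type*} [CommRing R] (z : R) (h : ℕ) : R :=
  (bandMatrix z h).det

/-- Laplace expansion along a first column supported in its first two entries. -/
theorem Matrix.det_eq_of_column_zero_eq_zero {R : Type*} [CommRing R] {n : ℕ}
    (A : Matrix (Fin (n + 2)) (Fin (n + 2)) R) (hA : ∀ i : Fin n, A i.succ.succ 0 = 0) :
    A.det = A 0 0 * (A.submatrix Fin.succ Fin.succ).det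
      - A 1 0 * (A.submatrix (Fin.succAbove 1) Fin.succ).det := by
  rw [Matrix.det_succ_column_zero, Fin.sum_univ_succ, Fin.sum_univ_succ]
  simp [hA, sub_eq_add_neg]

/-- Laplace expansion along a first row supported in its first entry. -/
theorem Matrix.det_eq_of_row_zero_eq_zero {R : Type*} [CommRing R] {n : ℕ}
    (A : Matrix (Fin (n + 1)) (Fin (n + 1)) R) (hA : ∀ j : Fin n, A 0 j.succ = 0) :
    A.det = A 0 0 * (A.submatrix Fin.succ Fin.succ).det := by
  rw [Matrix.det_succ_row_zero, Fin.sum_univ_succ]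
  simp [hA]

theorem bandMatrix_submatrix_succ {R : Type*} [CommRing R] (z : R) (n : ℕ) :
    (bandMatrix z (n + 1)).submatrix Fin.succ Fin.succ = bandMatrix z n := by
  ext i j
  simp [bandMatrix, add_right_comm _ 1]

theorem Ddet_recurrence {R : Type*} [CommRing R] (z : R) (h : ℕ) (hh : 3 ≤ h) :
    Ddet z h = Ddet z (h - 1) - 2 * z ^ 3 * Ddet z (h - 2) + z ^ 6 * Ddet z (h - 3) := by
  obtain ⟨n, rfl⟩ := Nat.exists_eq_add_of_le' hh
  change (bandMatrix z (n + 3)).det = (bandMatrix z (n + 2)).det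
    - 2 * z ^ 3 * (bandMatrix z (n + 1)).det + z ^ 6 * (bandMatrix z n).det
  have succAbove_comp_succ (m : ℕ) :
      (Fin.succAbove (1 : Fin (m + 2))) ∘ Fin.succ = Fin.succ ∘ Fin.succ := by
    funext i
    simp
  have two_mod : 2 % (n + 3) = 2 := Nat.mod_eq_of_lt (by lia)
  set B := (bandMatrix z (n + 3)).submatrix (Fin.succAbove 1) Fin.succ with hB
  set C := B.submatrix (Fin.succAbove 1) Fin.succ with hC
  have hBsub : B.submatrix Fin.succ Fin.succ = bandMatrix z (n + 1) := by
    rw [hB, Matrix.submatrix_submatrix, succAbove_comp_succ, ← Matrix.submatrix_submatrix,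
      bandMatrix_submatrix_succ, bandMatrix_submatrix_succ]
  have hCsub : C.submatrix Fin.succ Fin.succ = bandMatrix z n := by
    rw [hC, Matrix.submatrix_submatrix, succAbove_comp_succ, ← Matrix.submatrix_submatrix,
      hBsub, bandMatrix_submatrix_succ]
  have hA : (bandMatrix z (n + 3)).det = (bandMatrix z (n + 2)).det + z ^ 2 * B.det := by
    rw [Matrix.det_eq_of_column_zero_eq_zero _ fun i => by simp [bandMatrix],
      bandMatrix_submatrix_succ, ← hB]
    simp [bandMatrix]
  have hBdet : B.det = -(2 * z) * (bandMatrix z (n + 1)).det + z ^ 2 * C.det := by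
    rw [Matrix.det_eq_of_column_zero_eq_zero B fun i => by
      simp [hB, bandMatrix], hBsub, ← hC]
    simp [hB, bandMatrix, two_mod, sub_eq_add_neg]
  have hCdet : C.det = z ^ 2 * (bandMatrix z n).det := by
    rw [Matrix.det_eq_of_row_zero_eq_zero C fun j => by simp [hC, hB, bandMatrix], hCsub]
    simp [hC, hB, bandMatrix, two_mod]
  rw [hA, hBdet, hCdet]
  ring
end

section
/- Let t, z, W be real numbers with z³ = t(1-t)² and W² = 4t - 3t². Then each of the three numbers r₁ = (t-1)², r₂ = (t/2)(2 - t + W), r₃ = (t/2)(2 - t - W) is a root of the polynomial X³ - X² + 2z³·X - z⁶. -/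
theorem cubic_eq_factored {t z : ℝ} (hz : z ^ 3 = t * (1 - t) ^ 2) (X : ℝ) :
    X ^ 3 - X ^ 2 + 2 * z ^ 3 * X - z ^ 6 =
      (X - (t - 1) ^ 2) * (X ^ 2 - t * (2 - t) * X + t ^ 2 * (1 - t) ^ 2) := by
  linear_combination (2 * X - z ^ 3 - t * (1 - t) ^ 2) * hz

theorem quadratic_factor_eq_zero {t W : ℝ} (hW : W ^ 2 = 4 * t - 3 * t ^ 2) :
    ((t / 2) * (2 - t + W)) ^ 2 - t * (2 - t) * ((t / 2) * (2 - t + W))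
      + t ^ 2 * (1 - t) ^ 2 = 0 := by
  linear_combination t ^ 2 / 4 * hW

theorem roots_of_characteristic_cubic (t z W : ℝ)
    (hz : z ^ 3 = t * (1 - t) ^ 2) (hW : W ^ 2 = 4 * t - 3 * t ^ 2) :
    ((t - 1) ^ 2) ^ 3 - ((t - 1) ^ 2) ^ 2 + 2 * z ^ 3 * ((t - 1) ^ 2) - z ^ 6 = 0 ∧
    ((t / 2) * (2 - t + W)) ^ 3 - ((t / 2) * (2 - t + W)) ^ 2
      + 2 * z ^ 3 * ((t / 2) * (2 - t + W)) - z ^ 6 = 0 ∧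
    ((t / 2) * (2 - t - W)) ^ 3 - ((t / 2) * (2 - t - W)) ^ 2
      + 2 * z ^ 3 * ((t / 2) * (2 - t - W)) - z ^ 6 = 0 := by
  refine ⟨?_, ?_, ?_⟩
  · rw [cubic_eq_factored hz, sub_self, zero_mul]
  · rw [cubic_eq_factored hz, quadratic_factor_eq_zero hW, mul_zero]
  · have hW' : (-W) ^ 2 = 4 * t - 3 * t ^ 2 := by rwa [neg_sq]
    rw [cubic_eq_factored hz, sub_eq_add_neg (2 - t) W, quadratic_factor_eq_zero hW', mul_zero]
end

section
/- Let t be a real number with 4t - 3t² ≥ 0, t ≠ 1/3 and t ≠ 4/3, let W = √(4t - 3t²), and let z be a real number with z³ = t(1-t)². Define the sequence D_h by D_0 = 1, D_1 = 1, D_2 = 1 - 2z³, and D_h = D_{h-1} - 2z³D_{h-2} + z⁶D_{h-3} for h ≥ 3. Then for every h ≥ 0, D_h = A·r₁^h + B·r₂^h + C·r₃^h, where r₁ = (t-1)², r₂ = (t/2)(2-t+W), r₃ = (t/2)(2-t-W), A = (t-1)/(3t-1), B = (3t² - 4t - W)/((3t-1)(3t-4)), and C = (3t² - 4t + W)/((3t-1)(3t-4)).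 -/
/-- Two sequences satisfying the same third-order linear recurrence and agreeing at
`0`, `1` and `2` are equal. -/
theorem eq_of_third_order_recurrence {R : Type*} [CommRing R] {a b c : R} {u v : ℕ → R}
    (hu : ∀ n, u (n + 3) = a * u (n + 2) + b * u (n + 1) + c * u n)
    (hv : ∀ n, v (n + 3) = a * v (n + 2) + b * v (n + 1) + c * v n)
    (h0 : u 0 = v 0) (h1 : u 1 = v 1) (h2 : u 2 = v 2) (n : ℕ) : u n = v n := by
  induction n using Nat.strong_induction_on with
  | _ n ih =>
    match n, ih with
    | 0, _ => exact h0
    | 1, _ => exact h1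
    | 2, _ => exact h2
    | n + 3, ih =>
      rw [hu, hv, ih n (by omega), ih (n + 1) (by omega), ih (n + 2) (by omega)]

theorem binet_formula_for_D (t z W : ℝ)
    (ht : 4 * t - 3 * t ^ 2 ≥ 0) (ht1 : t ≠ 1 / 3) (ht2 : t ≠ 4 / 3)
    (hW : W = Real.sqrt (4 * t - 3 * t ^ 2))
    (hz : z ^ 3 = t * (1 - t) ^ 2)
    (D : ℕ → ℝ) (hD0 : D 0 = 1) (hD1 : D 1 = 1) (hD2 : D 2 = 1 - 2 * z ^ 3)
    (hDrec : ∀ h : ℕ, 3 ≤ h →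
      D h = D (h - 1) - 2 * z ^ 3 * D (h - 2) + z ^ 6 * D (h - 3)) :
    ∀ h : ℕ,
      D h = (t - 1) / (3 * t - 1) * ((t - 1) ^ 2) ^ h
        + (3 * t ^ 2 - 4 * t - W) / ((3 * t - 1) * (3 * t - 4)) * ((t / 2) * (2 - t + W)) ^ h
        + (3 * t ^ 2 - 4 * t + W) / ((3 * t - 1) * (3 * t - 4)) * ((t / 2) * (2 - t - W)) ^ h := by
  have hWsq : W ^ 2 = 4 * t - 3 * t ^ 2 := by rw [hW, Real.sq_sqrt ht]
  have hz6 : z ^ 6 = (t * (1 - t) ^ 2) ^ 2 := by rw [← hz]; ring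
  have hd1 : t * 3 - 1 ≠ 0 := fun h => ht1 (by linarith)
  have hd2 : t * 3 - 4 ≠ 0 := fun h => ht2 (by linarith)
  have root₁ : ((t - 1) ^ 2) ^ 3
      = ((t - 1) ^ 2) ^ 2 - 2 * z ^ 3 * (t - 1) ^ 2 + z ^ 6 := by
    rw [hz6, hz]; ring
  have quadratic : ∀ w : ℝ, w ^ 2 = 4 * t - 3 * t ^ 2 →
      (t / 2 * (2 - t + w)) ^ 2
        = t * (2 - t) * (t / 2 * (2 - t + w)) - t ^ 2 * (1 - t) ^ 2 := by
    intro w hw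
    linear_combination t ^ 2 / 4 * hw
  have cubic : ∀ w : ℝ, w ^ 2 = 4 * t - 3 * t ^ 2 →
      (t / 2 * (2 - t + w)) ^ 3 = (t / 2 * (2 - t + w)) ^ 2
        - 2 * z ^ 3 * (t / 2 * (2 - t + w)) + z ^ 6 := by
    intro w hw
    rw [hz6, hz]
    linear_combination (t / 2 * (2 - t + w) - (t - 1) ^ 2) * quadratic w hw
  have root₂ := cubic W hWsq
  have root₃ := cubic (-W) (by rw [neg_sq, hWsq])
  rw [← sub_eq_add_neg] at root₃
  refine eq_of_third_order_recurrence (a := 1) (b := -(2 * z ^ 3)) (c := z ^ 6) ?_ ?_ ?_ ?_ ?_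
  · intro n
    have h := hDrec (n + 3) (by omega)
    simp only [Nat.add_sub_cancel, show n + 3 - 1 = n + 2 by omega,
      show n + 3 - 2 = n + 1 by omega] at h
    rw [h]; ring
  · intro n
    simp only [pow_add _ n]
    rw [root₁, root₂, root₃]
    ring
  · rw [hD0]; field_simp; ring
  · rw [hD1]; field_simp
    linear_combination 2 * t * hWsq
  · rw [hD2, hz]; field_simp
    linear_combination -t ^ 2 * (2 * t * (3 * t - 4) - 4 * (2 - t)) * hWsq
end

section
/- Let K be a field, and let z, t ∈ K with z ≠ 0, t ≠ 1 and z³ = t(1-t)². Define f_k = t^k/(z^k(1-t)) for k ≥ 0. Then f_0 - z·f_1 = 1, and for every k ≥ 1, f_k = z²·f_{k-1} + 2z·f_{k+1} - z²·f_{k+2}. -/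
theorem f_solves_eliminated_system {K : Type*} [Field K] (z t : K)
    (hz : z ≠ 0) (ht : t ≠ 1) (hzt : z ^ 3 = t * (1 - t) ^ 2)
    (f : ℕ → K) (hf : ∀ k : ℕ, f k = t ^ k / (z ^ k * (1 - t))) :
    f 0 - z * f 1 = 1 ∧
    ∀ k : ℕ, 1 ≤ k →
      f k = z ^ 2 * f (k - 1) + 2 * z * f (k + 1) - z ^ 2 * f (k + 2) := by
  have ht' : 1 - t ≠ 0 := sub_ne_zero.mpr ht.symm
  have hstep : ∀ k, z * f (k + 1) = t * f k := by
    intro k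
    rw [hf, hf, pow_succ, pow_succ]
    field_simp
  constructor
  · rw [hstep 0, hf 0, pow_zero, pow_zero]
    field_simp
  · intro k hk
    obtain ⟨m, rfl⟩ := Nat.exists_eq_add_of_le' hk
    rw [Nat.add_sub_cancel]
    have h₀ := hstep m
    have h₁ := hstep (m + 1)
    have h₂ := hstep (m + 2)
    apply mul_left_cancel₀ hz
    linear_combination (1 - 2 * t + t ^ 2) * h₀ + (t * z - 2 * z) * h₁ + z ^ 2 * h₂ - f m * hzt
end

section
/- Let K be a field, and let z, t ∈ K with z ≠ 0, t ≠ 1 and z³ = t(1-t)². Define f_k = t^k/(z^k(1-t)) and g_k = t^{k+1}/z^{k+2} for k ≥ 0. Then f_0 = z·f_1 + 1; for every k ≥ 1, f_k = z·g_{k-1} + z·f_{k+1}; and for every k ≥ 0, g_k = z·f_k + z·g_{k+1}. -/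
theorem f_g_solve_system {K : Type*} [Field K] (z t : K)
    (hz : z ≠ 0) (ht : t ≠ 1) (hzt : z ^ 3 = t * (1 - t) ^ 2)
    (f g : ℕ → K)
    (hf : ∀ k : ℕ, f k = t ^ k / (z ^ k * (1 - t)))
    (hg : ∀ k : ℕ, g k = t ^ (k + 1) / z ^ (k + 2)) :
    f 0 = z * f 1 + 1 ∧
    (∀ k : ℕ, 1 ≤ k → f k = z * g (k - 1) + z * f (k + 1)) ∧
    (∀ k : ℕ, g k = z * f k + z * g (k + 1)) := by
  have ht' : 1 - t ≠ 0 := sub_ne_zero.mpr ht.symm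
  refine ⟨?_, fun k hk => ?_, fun k => ?_⟩
  · rw [hf, hf]
    field_simp
    ring
  · obtain ⟨j, rfl⟩ := Nat.exists_eq_add_of_le' hk
    rw [hf, hf, hg, Nat.add_sub_cancel]
    field_simp
    ring
  · have hstep : t * (1 - t) / z ^ 2 = z / (1 - t) := by
      rw [div_eq_div_iff (pow_ne_zero 2 hz) ht']
      linear_combination -hzt
    calc g k = t ^ k / z ^ k * (t * (1 - t) / z ^ 2) + z * g (k + 1) := by
          rw [hg, hg]
          field_simp
          ring
      _ = z * f k + z * g (k + 1) := by
          rw [hstep, hf]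
          field_simp
end

section
/- For every i ≥ 0, τ_i = Σ_{0 ≤ l ≤ (i-1)/3} binom(i-l, 2l+1)·z^{3l} (the empty sum for i = 0 being 0). -/
/-- The sequence `τ` defined by `τ 0 = 0`, `τ 1 = 1`, `τ 2 = 2` and
`τ i = 2 τ (i-1) - τ (i-2) + z³ τ (i-3)` for `i ≥ 3`; equivalently
`∑ τ_i wⁱ = w / (1 - 2w + w² - z³w³)`. -/
def tau {R : Type*} [CommRing R] (z : R) : ℕ → R
  | 0 => 0
  | 1 => 1
  | 2 => 2
  | i + 3 => 2 * tau z (i + 2) - tau z (i + 1) + z ^ 3 * tau z i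

theorem sum_choose_eq_of_le {R : Type*} [CommRing R] (z : R) {i n : ℕ} (h : (i + 2) / 3 ≤ n) :
    ∑ l ∈ Finset.range ((i + 2) / 3), (Nat.choose (i - l) (2 * l + 1) : R) * z ^ (3 * l) =
      ∑ l ∈ Finset.range n, (Nat.choose (i - l) (2 * l + 1) : R) * z ^ (3 * l) := by
  refine Finset.sum_subset (Finset.range_mono h) fun l _ hl => ?_
  rw [Finset.mem_range] at hl
  rw [Nat.choose_eq_zero_of_lt (by omega), Nat.cast_zero, zero_mul]

theorem choose_add_two_add_choose (m k : ℕ) :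
    (m + 2).choose (k + 2) + m.choose (k + 2) = 2 * (m + 1).choose (k + 2) + m.choose k := by
  have h₁ : (m + 2).choose (k + 2) = (m + 1).choose (k + 1) + (m + 1).choose (k + 2) :=
    Nat.choose_succ_succ' (m + 1) (k + 1)
  have h₂ : (m + 1).choose (k + 2) = m.choose (k + 1) + m.choose (k + 2) :=
    Nat.choose_succ_succ' m (k + 1)
  have h₃ := Nat.choose_succ_succ' m k
  omega

theorem tau_closed_form {R : Type*} [CommRing R] (z : R) (i : ℕ) :
    tau z i = ∑ l ∈ Finset.range ((i + 2) / 3),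
      (Nat.choose (i - l) (2 * l + 1) : R) * z ^ (3 * l) := by
  induction i using tau.induct with
  | case1 => simp [tau]
  | case2 => simp [tau]
  | case3 => simp [tau]
  | case4 i ih₂ ih₁ ih₀ =>
    rw [sum_choose_eq_of_le z (n := i + 2) (by omega)] at ih₁ ih₂ ⊢
    rw [sum_choose_eq_of_le z (n := i + 1) (by omega)] at ih₀
    rw [Finset.sum_range_succ'] at ih₁ ih₂ ⊢
    rw [tau, ih₀, ih₁, ih₂]
    have key : ∀ l ∈ Finset.range (i + 1),
        (Nat.choose (i + 3 - (l + 1)) (2 * (l + 1) + 1) : R) * z ^ (3 * (l + 1)) =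
          2 * ((Nat.choose (i + 2 - (l + 1)) (2 * (l + 1) + 1) : R) * z ^ (3 * (l + 1))) -
          (Nat.choose (i + 1 - (l + 1)) (2 * (l + 1) + 1) : R) * z ^ (3 * (l + 1)) +
          z ^ 3 * ((Nat.choose (i - l) (2 * l + 1) : R) * z ^ (3 * l)) := by
      intro l hl
      rw [Finset.mem_range] at hl
      rw [show i + 3 - (l + 1) = i - l + 2 by omega, show i + 2 - (l + 1) = i - l + 1 by omega,
        show i + 1 - (l + 1) = i - l by omega, show 2 * (l + 1) + 1 = 2 * l + 1 + 2 by ring]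
      have h := congrArg (Nat.cast : ℕ → R) (choose_add_two_add_choose (i - l) (2 * l + 1))
      push_cast at h
      linear_combination z ^ (3 * l + 3) * h
    rw [Finset.sum_congr rfl key, Finset.sum_add_distrib, Finset.sum_sub_distrib,
      ← Finset.mul_sum, ← Finset.mul_sum]
    simp only [Nat.sub_zero, mul_zero, zero_add, Nat.choose_one_right, pow_zero, mul_one]
    push_cast
    ring
end

section
/- Let R be a commutative ring, let x, y ∈ R, and let k ≥ 0 be an integer. Then x^{k+1} - y^{k+1} = (x - y) · Σ_{i=0}^{⌊k/2⌋} (-1)^i · binom(k-i, i) · (x+y)^{k-2i} · (xy)^i. -/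
theorem choose_mul_pow_succ_succ {R : Type*} [CommRing R] (s t : R) (a b : ℕ) :
    (Nat.choose (a + 1) (b + 1) : R) * s ^ (a + 1 - (b + 1)) * t ^ (b + 1)
      = s * ((Nat.choose a (b + 1) : R) * s ^ (a - (b + 1)) * t ^ (b + 1))
        + t * ((Nat.choose a b : R) * s ^ (a - b) * t ^ b) := by
  rw [Nat.choose_succ_succ, Nat.add_sub_add_right]
  rcases lt_or_ge a (b + 1) with h | h
  · simp only [Nat.choose_eq_zero_of_lt h, Nat.cast_zero, add_zero]
    ring
  · obtain ⟨c, rfl⟩ := Nat.exists_eq_add_of_le h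
    rw [show b + 1 + c - b = c + 1 by omega, show b + 1 + c - (b + 1) = c by omega]
    push_cast
    ring

theorem sum_antidiagonal_choose_mul_pow_add_two {R : Type*} [CommRing R] (s t : R) (n : ℕ) :
    ∑ p ∈ Finset.HasAntidiagonal.antidiagonal (n + 2), (Nat.choose p.1 p.2 : R) * s ^ (p.1 - p.2) * t ^ p.2
      = s * ∑ p ∈ Finset.HasAntidiagonal.antidiagonal (n + 1),
          (Nat.choose p.1 p.2 : R) * s ^ (p.1 - p.2) * t ^ p.2
        + t * ∑ p ∈ Finset.HasAntidiagonal.antidiagonal n,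
          (Nat.choose p.1 p.2 : R) * s ^ (p.1 - p.2) * t ^ p.2 := by
  rw [Finset.Nat.antidiagonal_succ_succ', Finset.Nat.antidiagonal_succ']
  simp only [Finset.sum_cons, Finset.sum_map, Function.Embedding.prodMap,
    Function.Embedding.coeFn_mk, Prod.map, Function.Embedding.refl_apply,
    Nat.succ_eq_add_one, choose_mul_pow_succ_succ, Finset.sum_add_distrib, ← Finset.mul_sum]
  simp
  ring

theorem pow_succ_sub_pow_succ_eq_mul_sum_antidiagonal {R : Type*} [CommRing R] (x y : R) (k : ℕ) :
    x ^ (k + 1) - y ^ (k + 1)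
      = (x - y) * ∑ p ∈ Finset.HasAntidiagonal.antidiagonal k,
          (Nat.choose p.1 p.2 : R) * (x + y) ^ (p.1 - p.2) * (-(x * y)) ^ p.2 := by
  induction k using Nat.twoStepInduction with
  | zero => simp
  | one => simp [Finset.Nat.antidiagonal_succ]; ring
  | more n ih₀ ih₁ =>
    rw [sum_antidiagonal_choose_mul_pow_add_two]
    linear_combination (x + y) * ih₁ - x * y * ih₀

theorem girard_waring {R : Type*} [CommRing R] (x y : R) (k : ℕ) :
    x ^ (k + 1) - y ^ (k + 1)
      = (x - y) * ∑ i ∈ Finset.range (k / 2 + 1),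
          (-1) ^ i * (Nat.choose (k - i) i : R) * (x + y) ^ (k - 2 * i) * (x * y) ^ i := by
  rw [pow_succ_sub_pow_succ_eq_mul_sum_antidiagonal, ← Finset.Nat.sum_antidiagonal_swap,
    Finset.Nat.sum_antidiagonal_eq_sum_range_succ_mk]
  congr 1
  symm
  refine Finset.sum_subset_zero_on_sdiff ?_ ?_ ?_
  · intro i
    simp only [Finset.mem_range]
    omega
  · intro i hi
    simp only [Finset.mem_sdiff, Finset.mem_range] at hi
    simp [Nat.choose_eq_zero_of_lt (show k - i < i by omega)]
  · intro i _
    simp only [Prod.fst_swap, Prod.snd_swap]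
    rw [show k - i - i = k - 2 * i by omega, neg_pow (x * y)]
    ring
end

section
/- Let t be a real number with 0 < t < 3 - 2√2, and let z = (t(1-t)²)^{1/3} be the real cube root. Define the sequence D_h by D_0 = 1, D_1 = 1, D_2 = 1 - 2z³, and D_h = D_{h-1} - 2z³D_{h-2} + z⁶D_{h-3} for h ≥ 3. Then for every fixed integer i ≥ 0, the quotient D_n / D_{n+i} tends to (t-1)^{-2i} = (1-t)^{-2i} as n → ∞. -/
open Filter Topology

/-- A solution of a second order linear recurrence whose characteristic roots are distinct and
lie in the open unit disc tends to zero. -/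
theorem tendsto_zero_of_linear_recurrence {α β : ℝ} (hα : |α| < 1) (hβ : |β| < 1) (hne : α ≠ β)
    {b : ℕ → ℝ} (hb : ∀ n, b (n + 2) = (α + β) * b (n + 1) - α * β * b n) :
    Tendsto b atTop (𝓝 0) := by
  have geom : ∀ x y : ℝ, (∀ n, b (n + 2) = (x + y) * b (n + 1) - x * y * b n) →
      ∀ n, b (n + 1) - x * b n = y ^ n * (b 1 - x * b 0) := by
    intro x y h n
    induction n with
    | zero => simp
    | succ n ih => rw [h n, pow_succ']; linear_combination y * ih
  have hu := geom α β hb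
  have hv := geom β α fun n => by rw [hb n]; ring
  have hsub : α - β ≠ 0 := sub_ne_zero.2 hne
  have hclosed : b = fun n =>
      (α ^ n * (b 1 - β * b 0) - β ^ n * (b 1 - α * b 0)) / (α - β) := by
    funext n
    rw [eq_div_iff hsub]
    linear_combination hv n - hu n
  rw [hclosed]
  simpa using (((tendsto_pow_atTop_nhds_zero_of_abs_lt_one hα).mul_const (b 1 - β * b 0)).sub
    ((tendsto_pow_atTop_nhds_zero_of_abs_lt_one hβ).mul_const (b 1 - α * b 0))).div_const (α - β)

theorem tendsto_of_affine_recurrence {α β : ℝ} (hα : |α| < 1) (hβ : |β| < 1) (hne : α ≠ β)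
    {a : ℕ → ℝ} (ha : ∀ n, a (n + 2) = (α + β) * a (n + 1) - α * β * a n + 1) :
    Tendsto a atTop (𝓝 ((1 - α) * (1 - β))⁻¹) := by
  have h1 : 1 - α ≠ 0 := (sub_pos.2 (abs_lt.1 hα).2).ne'
  have h2 : 1 - β ≠ 0 := (sub_pos.2 (abs_lt.1 hβ).2).ne'
  rw [← tendsto_sub_nhds_zero_iff]
  refine tendsto_zero_of_linear_recurrence hα hβ hne fun n => ?_
  rw [ha n]
  linear_combination -mul_inv_cancel₀ (mul_ne_zero h1 h2)

/-- If `D n / r ^ n` has a nonzero limit, then `D n / D (n + i)` tends to `r ^ (-i)`. -/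
theorem tendsto_quotient_of_tendsto_div_pow {D : ℕ → ℝ} {r c : ℝ} (hr : r ≠ 0) (hc : c ≠ 0)
    (h : Tendsto (fun n => D n / r ^ n) atTop (𝓝 c)) (i : ℕ) :
    Tendsto (fun n => D n / D (n + i)) atTop (𝓝 (r ^ i)⁻¹) := by
  have hlim := (h.div (h.comp (tendsto_add_atTop_nat i)) hc).mul_const (r ^ i)⁻¹
  rw [div_self hc, one_mul] at hlim
  refine hlim.congr fun n => ?_
  have hn := pow_ne_zero n hr
  have hi := pow_ne_zero i hr
  simp only [Pi.div_apply, Function.comp_apply, pow_add]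
  rcases eq_or_ne (D (n + i)) 0 with h0 | h0
  · simp [h0]
  · field_simp

theorem D_quotient_limit (t z : ℝ)
    (ht0 : 0 < t) (ht1 : t < 3 - 2 * Real.sqrt 2)
    (hz : z ^ 3 = t * (1 - t) ^ 2)
    (D : ℕ → ℝ) (hD0 : D 0 = 1) (hD1 : D 1 = 1) (hD2 : D 2 = 1 - 2 * z ^ 3)
    (hDrec : ∀ h : ℕ, 3 ≤ h →
      D h = D (h - 1) - 2 * z ^ 3 * D (h - 2) + z ^ 6 * D (h - 3)) :
    ∀ i : ℕ,
      Filter.Tendsto (fun n : ℕ => D n / D (n + i)) Filter.atTop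
        (nhds ((t - 1) ^ (-(2 * (i : ℤ))))) := by
  intro i
  have ht : t < 1 / 5 := by
    have : (7 / 5 : ℝ) < Real.sqrt 2 := Real.lt_sqrt_of_sq_lt (by norm_num)
    linarith
  have hz6 : z ^ 6 = (t * (1 - t) ^ 2) ^ 2 := by rw [← hz]; ring
  have hrec : ∀ n, D (n + 3) =
      D (n + 2) - 2 * (t * (1 - t) ^ 2) * D (n + 1) + (t * (1 - t) ^ 2) ^ 2 * D n := by
    intro n
    rw [← hz6, ← hz]
    exact hDrec (n + 3) (by omega)
  -- Splitting the root `(1 - t) ^ 2` off the characteristic polynomial lowers the order.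
  have hsecond : ∀ n, D (n + 2) =
      t * (2 - t) * D (n + 1) - t ^ 2 * (1 - t) ^ 2 * D n + ((1 - t) ^ 2) ^ (n + 2) := by
    intro n
    induction n with
    | zero => simp only [zero_add, hD0, hD1, hD2, hz]; ring
    | succ n ih =>
      rw [hrec n, pow_succ _ (n + 2)]
      linear_combination (1 - t) ^ 2 * ih
  have hr : 0 < (1 - t) ^ 2 := pow_pos (by linarith) 2
  have hdisc : 0 < t * (4 - 3 * t) := mul_pos ht0 (by linarith)
  set s := Real.sqrt (t * (4 - 3 * t)) with hs
  have hs0 : 0 < s := Real.sqrt_pos.2 hdisc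
  have hsq : s ^ 2 = t * (4 - 3 * t) := Real.sq_sqrt hdisc.le
  have hs2 : s < 2 - t := by
    rw [hs, Real.sqrt_lt' (by linarith)]
    nlinarith
  set α := t * (2 - t + s) / (2 * (1 - t) ^ 2) with hαdef
  set β := t * (2 - t - s) / (2 * (1 - t) ^ 2) with hβdef
  have hβ0 : 0 < β := div_pos (mul_pos ht0 (by linarith)) (by linarith)
  have hβα : β < α := by
    rw [hαdef, hβdef]
    gcongr
    linarith
  have hα1 : α < 1 := by
    rw [hαdef, div_lt_one (by linarith)]
    nlinarith
  have hα : |α| < 1 := abs_lt.2 ⟨by linarith, hα1⟩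
  have hβ : |β| < 1 := abs_lt.2 ⟨by linarith, by linarith⟩
  have h1t : 1 - t ≠ 0 := by linarith
  have hsum : α + β = t * (2 - t) / (1 - t) ^ 2 := by
    rw [hαdef, hβdef]; field_simp; ring
  have hprod : α * β = t ^ 2 / (1 - t) ^ 2 := by
    rw [hαdef, hβdef]; field_simp; linear_combination -hsq
  have hlim := tendsto_of_affine_recurrence hα hβ hβα.ne'
    (a := fun n => D n / ((1 - t) ^ 2) ^ n) fun n => by
      rw [hsum, hprod, hsecond n]
      simp only [pow_succ ((1 - t) ^ 2)]
      have hn := pow_ne_zero n hr.ne'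
      field_simp
  have hc : ((1 - α) * (1 - β))⁻¹ ≠ 0 :=
    inv_ne_zero (mul_pos (by linarith) (by linarith)).ne'
  convert tendsto_quotient_of_tendsto_div_pow hr.ne' hc hlim i using 2
  rw [zpow_neg, zpow_mul, zpow_natCast]
  norm_cast
  rw [sub_sq_comm]
end
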